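/- arXiv:2602.10602 — 2 statements merged into one kernel-verified Lean document; each statement's English description precedes it below -/
import Mathlib

section
/- Let K ≥ 1 and let π ∈ ℝᴷ be a strictly positive probability vector (π_k > 0, Σ_k π_k = 1). Let F = diag(π) − ππᵀ and G = diag(π)⁻¹ − 𝟙𝟙ᵀ, where 𝟙 is the all-ones vector. Then G is a reflexive generalized inverse of F: F·G·F = F and G·F·G = G. Moreover F·G = I − π𝟙ᵀ and G·F = I − 𝟙πᵀ. -/
open scoped Matrix

/-- **Generalized inverse of the categorical Fisher information matrix.**
For a strictly positive probability vector `w`, with `F = diag(w) - w wᵀ` and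
`G = diag(w)⁻¹ - 𝟙 𝟙ᵀ`, the matrix `G` is a reflexive generalized inverse of `F`:
`F G F = F` and `G F G = G`; moreover `F G = I - w 𝟙ᵀ` and `G F = I - 𝟙 wᵀ`. -/
theorem categorical_fim_generalized_inverse (K : ℕ) (hK : 1 ≤ K)
    (w : Fin K → ℝ) (hw : ∀ k, 0 < w k) (hw1 : ∑ k, w k = 1) :
    let F : Matrix (Fin K) (Fin K) ℝ := Matrix.diagonal w - Matrix.vecMulVec w w
    let G : Matrix (Fin K) (Fin K) ℝ :=
      Matrix.diagonal (fun k => (w k)⁻¹) -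
        Matrix.vecMulVec (fun _ => 1) (fun _ => 1)
    F * G * F = F ∧ G * F * G = G ∧
      F * G = 1 - Matrix.vecMulVec w (fun _ => 1) ∧
      G * F = 1 - Matrix.vecMulVec (fun _ => 1) w := by
  intro F G
  have inv_mul_w : ∀ k, (w k)⁻¹ * w k = 1 := fun k => inv_mul_cancel₀ (hw k).ne'
  have mul_inv_w : ∀ k, w k * (w k)⁻¹ = 1 := fun k => mul_inv_cancel₀ (hw k).ne'
  have ones_vecMul_F : (fun _ => 1) ᵥ* F = 0 := by
    ext k
    simp [F, Matrix.vecMul_sub, Matrix.vecMul_diagonal, Matrix.vecMul_vecMulVec, dotProduct, hw1]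
  have w_vecMul_G : w ᵥ* G = 0 := by
    ext k
    simp [G, Matrix.vecMul_sub, Matrix.vecMul_diagonal, Matrix.vecMul_vecMulVec, dotProduct, hw1,
      mul_inv_w]
  have F_mul_G : F * G = 1 - Matrix.vecMulVec w (fun _ => 1) := by
    have diagonal_mul_G : Matrix.diagonal w * G = 1 - Matrix.vecMulVec w (fun _ => 1) := by
      ext i j
      by_cases h : i = j <;>
        simp [G, Matrix.vecMulVec_apply, h, mul_sub,
          mul_inv_w]
    rw [show F * G = _ from sub_mul _ _ _, Matrix.vecMulVec_mul, w_vecMul_G, diagonal_mul_G]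
    simp
  have G_mul_F : G * F = 1 - Matrix.vecMulVec (fun _ => 1) w := by
    have diagonal_mul_F : Matrix.diagonal (fun k => (w k)⁻¹) * F =
        1 - Matrix.vecMulVec (fun _ => 1) w := by
      ext i j
      by_cases h : i = j <;>
        simp [F, Matrix.vecMulVec_apply, h, mul_sub,
          inv_mul_w, ← mul_assoc]
    rw [show G * F = _ from sub_mul _ _ _, Matrix.vecMulVec_mul, ones_vecMul_F, diagonal_mul_F]
    simp
  refine ⟨?_, ?_, F_mul_G, G_mul_F⟩
  · rw [F_mul_G, sub_mul, one_mul, Matrix.vecMulVec_mul, ones_vecMul_F]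
    simp
  · rw [G_mul_F, sub_mul, one_mul, Matrix.vecMulVec_mul, w_vecMul_G]
    simp
end

section
/- Let S be a nonempty finite set and let p : S × ℝⁿ → (0,∞) be a family of probability mass functions on S parametrized by θ ∈ ℝⁿ, with θ ↦ p(x, θ) twice differentiable for each x and Σ_{x∈S} p(x, θ) = 1 for all θ. Fix θ₀ ∈ ℝⁿ and define K(θ) = D_KL(p(·, θ₀) ‖ p(·, θ)) = Σ_{x∈S} p(x, θ₀) log(p(x, θ₀)/p(x, θ)). Then the Hessian of K at θ = θ₀ equals the Fisher information matrix F(θ₀) = −Σ_{x∈S} p(x, θ₀) · ∇²_θ log p(x, θ)|_{θ=θ₀}. -/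
/-- The second partial derivative `∂²f/∂θ_i∂θ_j` of a function
`f : (Fin n → ℝ) → ℝ` at the point `θ`, computed coordinatewise. -/
noncomputable def secondPartial {n : ℕ} (f : (Fin n → ℝ) → ℝ)
    (i j : Fin n) (θ : Fin n → ℝ) : ℝ :=
  deriv (fun a =>
    deriv (fun b => f (Function.update (Function.update θ i a) j b))
      (Function.update θ i a j)) (θ i)

/-- A partial derivative, computed with `Function.update`, is a directional derivative. -/
theorem hasDerivAt_comp_update {n : ℕ} {f : (Fin n → ℝ) → ℝ} {v : Fin n → ℝ}
    (hf : DifferentiableAt ℝ f v) (j : Fin n) :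
    HasDerivAt (fun b => f (Function.update v j b)) (fderiv ℝ f v (Pi.single j 1)) (v j) := by
  have h := hasDerivAt_update (𝕜 := ℝ) v j (v j)
  refine HasFDerivAt.comp_hasDerivAt (v j) ?_ h
  simpa using hf.hasFDerivAt

theorem secondPartial_eq {n : ℕ} {f : (Fin n → ℝ) → ℝ} (hf : ContDiff ℝ 2 f)
    (i j : Fin n) (θ : Fin n → ℝ) :
    secondPartial f i j θ =
      fderiv ℝ (fun v => fderiv ℝ f v (Pi.single j 1)) θ (Pi.single i 1) := by
  have hd : Differentiable ℝ f := hf.differentiable (by norm_num)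
  have hd' : Differentiable ℝ (fderiv ℝ f) :=
    (hf.fderiv_right (m := 1) (by norm_num)).differentiable (by norm_num)
  simp only [secondPartial, (hasDerivAt_comp_update (hd _) j).deriv]
  exact (hasDerivAt_comp_update
    (f := fun v => fderiv ℝ f v (Pi.single j 1)) (by fun_prop) i).deriv

theorem secondPartial_sum_const_sub_const_mul {ι : Type*} [Fintype ι] {n : ℕ}
    {g : ι → (Fin n → ℝ) → ℝ} (hg : ∀ x, ContDiff ℝ 2 (g x)) (a c : ι → ℝ)
    (i j : Fin n) (θ : Fin n → ℝ) :
    secondPartial (fun v => ∑ x, (a x - c x * g x v)) i j θ =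
      -∑ x, c x * secondPartial (g x) i j θ := by
  have hd (x) : Differentiable ℝ (g x) := (hg x).differentiable (by norm_num)
  have hd' (x) : Differentiable ℝ (fderiv ℝ (g x)) :=
    ((hg x).fderiv_right (m := 1) (by norm_num)).differentiable (by norm_num)
  have hfirst (v : Fin n → ℝ) : HasFDerivAt (fun v => ∑ x, (a x - c x * g x v))
      (∑ x, -(c x • fderiv ℝ (g x) v)) v :=
    HasFDerivAt.fun_sum fun x _ => ((hd x v).hasFDerivAt.const_mul (c x)).const_sub (a x)
  have hsecond : HasFDerivAt
      (fun v => ∑ x, -(c x * fderiv ℝ (g x) v (Pi.single j 1)))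
      (∑ x, -(c x • fderiv ℝ (fun v => fderiv ℝ (g x) v (Pi.single j 1)) θ)) θ :=
    HasFDerivAt.fun_sum fun x _ =>
      (DifferentiableAt.hasFDerivAt (by fun_prop)).const_mul (c x) |>.fun_neg
  rw [secondPartial_eq (by fun_prop)]
  simp only [(hfirst _).fderiv, secondPartial_eq (hg _), sum_apply, neg_apply, smul_apply,
    smul_eq_mul, hsecond.fderiv]
  exact Finset.sum_neg_distrib _

/-- **The Hessian of the KL divergence at its base point is the Fisher
information matrix.** For a family of strictly positive probability mass
functions `p` on a nonempty finite set `S`, twice differentiable in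
`θ ∈ ℝⁿ` with `∑ x, p x θ = 1` for all `θ`, the Hessian at `θ = θ₀` of
`K(θ) = ∑ x, p x θ₀ * log (p x θ₀ / p x θ)` equals entrywise the Fisher
information matrix `F(θ₀) = -∑ x, p x θ₀ * ∇²_θ log (p x θ)|_{θ₀}`. -/
theorem kl_hessian_eq_fisher_information (S : Type*) [Fintype S] [Nonempty S]
    (n : ℕ) (p : S → (Fin n → ℝ) → ℝ)
    (hpos : ∀ x θ, 0 < p x θ)
    (hdiff : ∀ x, ContDiff ℝ 2 (p x))
    (hsum : ∀ θ, ∑ x, p x θ = 1)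
    (θ₀ : Fin n → ℝ) :
    ∀ i j : Fin n,
      secondPartial (fun θ => ∑ x, p x θ₀ * Real.log (p x θ₀ / p x θ)) i j θ₀ =
        -∑ x, p x θ₀ * secondPartial (fun θ => Real.log (p x θ)) i j θ₀ := by
  intro i j
  have hlog (x) : ContDiff ℝ 2 (fun θ => Real.log (p x θ)) :=
    (hdiff x).log fun θ => (hpos x θ).ne'
  simp only [Real.log_div (hpos _ _).ne' (hpos _ _).ne', mul_sub]
  exact secondPartial_sum_const_sub_const_mul hlog _ _ i j θ₀
end
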